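/- Let G be an almost Moore digraph of degree d > 1 and diameter k > 1 and let α > 1 be an integer. Then the subdigraph H_α is diregular: there exists d' such that every vertex of H_α has out-degree d' and in-degree d' within H_α. -/

import Mathlib

/-- `IsWalkFrom A u v l` : the list `u :: l` is a directed walk from `u` to `v`
along the adjacency relation `A`; the length of the walk is `l.length`. -/
def IsWalkFrom {V : Type} (A : V → V → Prop) (u v : V) (l : List V) : Prop :=
  List.Chain A u l ∧ (u :: l).getLast (List.cons_ne_nil u l) = v

/-- An almost Moore digraph (a `(d,k)`-digraph): a diregular digraph of degree `d > 1`,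
diameter `k > 1` and order `d + d² + ⋯ + d^k`, together with its repeat permutation `rep`:
for every vertex `v`, every vertex `w ≠ rep v` is reached from `v` by exactly one walk of
length at most `k`, while `rep v` is reached by exactly two such walks, at least one of
which has length `k`.  The map `rep` is an automorphism of the digraph. -/
structure AlmostMooreDigraph (d k : ℕ) where
  hd : 1 < d
  hk : 1 < k
  V : Type
  [fintypeV : Fintype V]
  [decEqV : DecidableEq V]
  Adj : V → V → Prop
  [adjDec : DecidableRel Adj]
  loopless : ∀ v, ¬ Adj v v
  out_deg : ∀ v, {w | Adj v w}.ncard = d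
  in_deg : ∀ v, {w | Adj w v}.ncard = d
  reach : ∀ u v, ∃ l, IsWalkFrom Adj u v l ∧ l.length ≤ k
  diam : ∃ u v, ∀ l, IsWalkFrom Adj u v l → k ≤ l.length
  card_eq : Fintype.card V = ∑ i ∈ Finset.range k, d ^ (i + 1)
  rep : V → V
  rep_spec : ∀ v w, w ≠ rep v → ∃! l, IsWalkFrom Adj v w l ∧ l.length ≤ k
  rep_two : ∀ v, ∃ l₁ l₂, l₁ ≠ l₂ ∧
      IsWalkFrom Adj v (rep v) l₁ ∧ l₁.length ≤ k ∧
      IsWalkFrom Adj v (rep v) l₂ ∧ l₂.length ≤ k ∧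
      (l₁.length = k ∨ l₂.length = k) ∧
      (∀ l, IsWalkFrom Adj v (rep v) l → l.length ≤ k → l = l₁ ∨ l = l₂)
  rep_bijective : Function.Bijective rep
  rep_adj : ∀ u v, Adj u v ↔ Adj (rep u) (rep v)

attribute [instance] AlmostMooreDigraph.fintypeV AlmostMooreDigraph.decEqV
  AlmostMooreDigraph.adjDec

/-- `ordRep M v` : the smallest `t ≥ 1` with `rep^t v = v`. -/
noncomputable def ordRep {d k : ℕ} (M : AlmostMooreDigraph d k) (v : M.V) : ℕ :=
  sInf {t | 0 < t ∧ M.rep^[t] v = v}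

/-- The vertex set of the subdigraph `H_α`: vertices whose order under the repeat
permutation divides `2^t * α` for some `t ≥ 0`. -/
def Hset {d k : ℕ} (M : AlmostMooreDigraph d k) (α : ℕ) : Set M.V :=
  {v | ∃ t : ℕ, ordRep M v ∣ 2 ^ t * α}

theorem isWalkFrom_nil {V : Type} (A : V → V → Prop) (u v : V) :
    IsWalkFrom A u v [] ↔ u = v := by
  simp [IsWalkFrom, List.Chain]

theorem isWalkFrom_cons {V : Type} (A : V → V → Prop) (u v w : V) (l : List V) :
    IsWalkFrom A u v (w :: l) ↔ A u w ∧ IsWalkFrom A w v l := by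
  simp [IsWalkFrom, List.Chain, and_assoc]

theorem IsWalkFrom.map {V : Type} {A : V → V → Prop} {f : V → V}
    (hf : ∀ u v, A u v → A (f u) (f v)) {u v : V} {l : List V} (h : IsWalkFrom A u v l) :
    IsWalkFrom A (f u) (f v) (l.map f) := by
  induction l generalizing u with
  | nil => rw [isWalkFrom_nil] at h; rw [List.map_nil, isWalkFrom_nil, h]
  | cons w l ih =>
    rw [isWalkFrom_cons] at h
    rw [List.map_cons, isWalkFrom_cons]
    exact ⟨hf _ _ h.1, ih h.2⟩

/-- Walks inside a subset `H` are the walks all of whose vertices lie in `H`. -/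
theorem isWalkFrom_restrict_iff {V : Type} {A : V → V → Prop} {H : Set V} {u v : V} {l : List V}
    (hu : u ∈ H) :
    IsWalkFrom (fun x y => x ∈ H ∧ y ∈ H ∧ A x y) u v l ↔
      IsWalkFrom A u v l ∧ ∀ x ∈ l, x ∈ H := by
  induction l generalizing u with
  | nil => simp [isWalkFrom_nil]
  | cons w l ih =>
    simp only [isWalkFrom_cons, List.forall_mem_cons]
    constructor
    · rintro ⟨⟨-, hw, ha⟩, h⟩
      have := (ih hw).1 h
      exact ⟨⟨ha, this.1⟩, hw, this.2⟩
    · rintro ⟨⟨ha, h⟩, hw, hl⟩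
      exact ⟨⟨hu, hw, ha⟩, (ih hw).2 ⟨h, hl⟩⟩

section WalkCount

open Classical in
/-- The finite set of walks of length `n` from `u` to `v`. -/
noncomputable def walkFinset {V : Type} [Fintype V] (B : V → V → Prop) :
    ℕ → V → V → Finset (List V)
  | 0, u, v => if u = v then {[]} else ∅
  | n + 1, u, v => Finset.univ.biUnion fun w =>
      if B u w then (walkFinset B n w v).image (List.cons w) else ∅

open Classical in
theorem mem_walkFinset {V : Type} [Fintype V] {B : V → V → Prop} {n : ℕ} {u v : V}
    {l : List V} : l ∈ walkFinset B n u v ↔ IsWalkFrom B u v l ∧ l.length = n := by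
  induction n generalizing u l with
  | zero =>
    cases l <;> by_cases h : u = v <;> simp [walkFinset, isWalkFrom_nil, h]
  | succ n ih =>
    cases l with
    | nil =>
      simp only [walkFinset, Finset.mem_biUnion]
      constructor
      · rintro ⟨w, -, h⟩
        split_ifs at h <;> simp at h
      · simp
    | cons x l =>
      simp only [walkFinset, Finset.mem_biUnion, Finset.mem_univ, true_and, isWalkFrom_cons,
        List.length_cons, Nat.add_right_cancel_iff]
      constructor
      · rintro ⟨w, h⟩
        split_ifs at h with hw
        · obtain ⟨l', hl', he⟩ := Finset.mem_image.1 h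
          obtain ⟨rfl, rfl⟩ := List.cons.inj he
          have := ih.1 hl'
          exact ⟨⟨hw, this.1⟩, this.2⟩
        · simp at h
      · rintro ⟨⟨hx, h⟩, hl⟩
        refine ⟨x, ?_⟩
        rw [if_pos hx]
        exact Finset.mem_image_of_mem _ (ih.2 ⟨h, hl⟩)

open Classical in
theorem card_walkFinset {V : Type} [Fintype V] (B : V → V → Prop) (n : ℕ) (u v : V) :
    (walkFinset B n u v).card = ((Matrix.of fun x y => if B x y then 1 else 0) ^ n) u v := by
  induction n generalizing u with
  | zero =>
    by_cases h : u = v <;> simp [walkFinset, h]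
  | succ n ih =>
    rw [pow_succ', Matrix.mul_apply, walkFinset, Finset.card_biUnion]
    · refine Finset.sum_congr rfl fun w _ => ?_
      rw [← ih, Matrix.of_apply]
      split_ifs
      · rw [Finset.card_image_of_injective _ List.cons_injective, one_mul]
      · simp
    · intro x _ y _ hxy
      rw [Function.onFun, Finset.disjoint_left]
      intro l hx hy
      split_ifs at hx hy <;> simp_all
      grind

open Classical in
/-- If the number of walks of length at most `k` between vertices of `H` is `1`, plus one more
from each `w` to `r w`, for an automorphism `r`, then out-degrees equal in-degrees. -/
theorem ncard_out_eq_ncard_in {V : Type} [Fintype V] (B : V → V → Prop) (H : Set V) (k : ℕ)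
    (r : V → V) (hr : Function.Injective r)
    (hBH : ∀ u v, B u v → u ∈ H ∧ v ∈ H)
    (hB : ∀ u v, B u v ↔ B (r u) (r v))
    (hcount : ∀ u ∈ H, ∀ v ∈ H,
      ∑ i ∈ Finset.range (k + 1), (walkFinset B i u v).card = 1 + if v = r u then 1 else 0)
    {u v : V} (hu : u ∈ H) (hv : v ∈ H) (hrv : r v ∈ H) :
    {w | B u w}.ncard = {w | B w (r v)}.ncard := by
  set M : Matrix V V ℕ := Matrix.of fun x y => if B x y then 1 else 0 with hM
  have hS : ∀ x y, (∑ i ∈ Finset.range (k + 1), M ^ i) x y =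
      ∑ i ∈ Finset.range (k + 1), (walkFinset B i x y).card := by
    intro x y
    simp only [Matrix.sum_apply, card_walkFinset, hM]
  have hcomm : M * (∑ i ∈ Finset.range (k + 1), M ^ i) =
      (∑ i ∈ Finset.range (k + 1), M ^ i) * M := by
    rw [Finset.mul_sum, Finset.sum_mul]
    exact Finset.sum_congr rfl fun i _ => (Commute.self_pow M i).eq
  have h := congrFun (congrFun hcomm u) (r v)
  rw [Matrix.mul_apply, Matrix.mul_apply] at h
  have h₁ : ∀ w, M u w * (∑ i ∈ Finset.range (k + 1), M ^ i) w (r v) =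
      (if B u w then 1 else 0) + if w = v then (if B u v then 1 else 0) else 0 := by
    intro w
    by_cases hw : B u w
    · rw [hS, hcount w (hBH _ _ hw).2 _ hrv]
      by_cases hwv : w = v
      · subst hwv; simp [hM, hw]
      · simp [hM, hw, hwv, hr.eq_iff, Ne.symm hwv]
    · by_cases hwv : w = v
      · subst hwv; simp [hM, hw]
      · simp [hM, hw, hwv]
  have h₂ : ∀ w, (∑ i ∈ Finset.range (k + 1), M ^ i) u w * M w (r v) =
      (if B w (r v) then 1 else 0) + if w = r u then (if B u v then 1 else 0) else 0 := by
    intro w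
    by_cases hw : B w (r v)
    · rw [hS, hcount u hu _ (hBH _ _ hw).1]
      by_cases hwv : w = r u
      · subst hwv; simp [hM, hw, hB u v]
      · simp [hM, hw, hwv]
    · by_cases hwv : w = r u
      · subst hwv; simp [hM, hw, hB u v]
      · simp [hM, hw, hwv]
  simp only [h₁, h₂, Finset.sum_add_distrib, Finset.sum_ite_eq', Finset.mem_univ, if_true,
    Nat.add_right_cancel_iff, Finset.sum_boole, Nat.cast_id] at h
  simpa [Set.ncard_eq_toFinset_card'] using h

end WalkCount

theorem ordRep_eq_minimalPeriod {d k : ℕ} (M : AlmostMooreDigraph d k) (v : M.V) :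
    ordRep M v = Function.minimalPeriod M.rep v := by
  have hper : v ∈ Function.periodicPts M.rep :=
    M.rep_bijective.1.mem_periodicPts v
  have hmem : 0 < Function.minimalPeriod M.rep v ∧ M.rep^[Function.minimalPeriod M.rep v] v = v :=
    ⟨Function.minimalPeriod_pos_of_mem_periodicPts hper, Function.isPeriodicPt_minimalPeriod _ _⟩
  have hinf : ordRep M v ∈ {t | 0 < t ∧ M.rep^[t] v = v} := Nat.sInf_mem ⟨_, hmem⟩
  exact le_antisymm (Nat.sInf_le hmem) (Function.IsPeriodicPt.minimalPeriod_le hinf.1 hinf.2)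

theorem mem_Hset_iff {d k : ℕ} (M : AlmostMooreDigraph d k) (α : ℕ) (v : M.V) :
    v ∈ Hset M α ↔ ∃ t : ℕ, Function.IsPeriodicPt M.rep (2 ^ t * α) v := by
  simp only [Hset, Set.mem_ofPred_eq, ordRep_eq_minimalPeriod,
    Function.isPeriodicPt_iff_minimalPeriod_dvd]

theorem rep_mem_Hset_iff {d k : ℕ} (M : AlmostMooreDigraph d k) (α : ℕ) (v : M.V) :
    M.rep v ∈ Hset M α ↔ v ∈ Hset M α := by
  simp only [mem_Hset_iff, Function.IsPeriodicPt, Function.IsFixedPt,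
    ← Function.iterate_succ_apply, Function.iterate_succ_apply', M.rep_bijective.1.eq_iff]

theorem adj_iterate_rep {d k : ℕ} (M : AlmostMooreDigraph d k) (n : ℕ) {u v : M.V}
    (h : M.Adj u v) : M.Adj (M.rep^[n] u) (M.rep^[n] v) := by
  induction n with
  | zero => exact h
  | succ n ih =>
    rw [Function.iterate_succ_apply', Function.iterate_succ_apply', ← M.rep_adj]
    exact ih

/-- Short walks between vertices of `H_α` stay in `H_α`. -/
theorem mem_Hset_of_mem_walk {d k : ℕ} (M : AlmostMooreDigraph d k) (α : ℕ) {u v : M.V}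
    (hu : u ∈ Hset M α) (hv : v ∈ Hset M α) {l : List M.V} (hl : IsWalkFrom M.Adj u v l)
    (hlk : l.length ≤ k) : ∀ x ∈ l, x ∈ Hset M α := by
  obtain ⟨s, hs⟩ := (mem_Hset_iff M α u).1 hu
  obtain ⟨t, ht⟩ := (mem_Hset_iff M α v).1 hv
  set n := 2 ^ (s + t) * α with hn
  have hun : M.rep^[n] u = u := by
    refine Function.IsPeriodicPt.trans_dvd hs ⟨2 ^ t, ?_⟩
    rw [hn]; ring
  have hvn : M.rep^[n] v = v := by
    refine Function.IsPeriodicPt.trans_dvd ht ⟨2 ^ s, ?_⟩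
    rw [hn]; ring
  set f : List M.V → List M.V := List.map M.rep^[n] with hf
  have hfinj : Function.Injective f :=
    List.map_injective_iff.2 (M.rep_bijective.1.iterate n)
  have hfw : ∀ l, IsWalkFrom M.Adj u v l → IsWalkFrom M.Adj u v (f l) := by
    intro l h
    have := IsWalkFrom.map (f := M.rep^[n]) (hf := fun _ _ ha => adj_iterate_rep M n ha) h
    rwa [hun, hvn] at this
  have hfl : ∀ l, (f l).length = l.length := fun l => List.length_map _
  have hff : f (f l) = l := by
    by_cases huv : v = M.rep u
    · obtain ⟨l₁, l₂, -, -, -, -, -, -, hall⟩ := M.rep_two u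
      rw [← huv] at hall
      have h₀ := hall l hl hlk
      have h₁ := hall (f l) (hfw _ hl) (by rwa [hfl])
      have h₂ := hall (f (f l)) (hfw _ (hfw _ hl)) (by rwa [hfl, hfl])
      by_cases h : f l = l
      · rw [h, h]
      · have h' : f (f l) ≠ f l := fun h' => h (hfinj h')
        grind
    · have h : f l = l := (M.rep_spec u v huv).unique ⟨hfw _ hl, by rwa [hfl]⟩ ⟨hl, hlk⟩
      rw [h, h]
  intro x hx
  refine (mem_Hset_iff M α x).2 ⟨s + t + 1, ?_⟩
  have h2 : M.rep^[n] (M.rep^[n] x) = x := by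
    have hmap : l.map (fun y => M.rep^[n] (M.rep^[n] y)) = l.map id := by
      rw [List.map_id]
      simpa [hf, Function.comp_def] using hff
    exact List.map_inj_left.1 hmap x hx
  rw [← Function.iterate_add_apply] at h2
  have h3 : 2 ^ (s + t + 1) * α = n + n := by rw [hn]; ring
  rw [h3]
  exact h2

theorem sum_card_walkFinset_Hset {d k : ℕ} (M : AlmostMooreDigraph d k) (α : ℕ) {u v : M.V}
    (hu : u ∈ Hset M α) (hv : v ∈ Hset M α) :
    ∑ i ∈ Finset.range (k + 1),
      (walkFinset (fun x y => x ∈ Hset M α ∧ y ∈ Hset M α ∧ M.Adj x y) i u v).card =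
      1 + if v = M.rep u then 1 else 0 := by
  rw [← Finset.card_biUnion]
  · set W := (Finset.range (k + 1)).biUnion fun i =>
      walkFinset (fun x y => x ∈ Hset M α ∧ y ∈ Hset M α ∧ M.Adj x y) i u v with hW
    have hmem : ∀ l, l ∈ W ↔ IsWalkFrom M.Adj u v l ∧ l.length ≤ k := by
      intro l
      simp only [hW, Finset.mem_biUnion, Finset.mem_range, mem_walkFinset,
        isWalkFrom_restrict_iff hu]
      constructor
      · rintro ⟨i, hi, ⟨h, -⟩, rfl⟩
        exact ⟨h, by lia⟩
      · rintro ⟨h, hk⟩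
        exact ⟨_, by lia, ⟨h, mem_Hset_of_mem_walk M α hu hv h hk⟩, rfl⟩
    split_ifs with h
    · obtain ⟨l₁, l₂, hne, hw₁, hk₁, hw₂, hk₂, -, hall⟩ := M.rep_two u
      rw [← h] at hw₁ hw₂ hall
      refine Finset.card_eq_two.2 ⟨l₁, l₂, hne, ?_⟩
      ext l
      rw [hmem, Finset.mem_insert, Finset.mem_singleton]
      constructor
      · exact fun hl => hall l hl.1 hl.2
      · rintro (rfl | rfl)
        exacts [⟨hw₁, hk₁⟩, ⟨hw₂, hk₂⟩]
    · obtain ⟨l₀, hl₀, huniq⟩ := M.rep_spec u v h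
      refine Finset.card_eq_one.2 ⟨l₀, ?_⟩
      ext l
      rw [hmem, Finset.mem_singleton]
      constructor
      · exact huniq l
      · rintro rfl
        exact hl₀
  · intro i _ j _ hij
    rw [Function.onFun, Finset.disjoint_left]
    intro l hi hj
    exact hij ((mem_walkFinset.1 hi).2.symm.trans (mem_walkFinset.1 hj).2)

theorem ncard_out_Hset_eq_ncard_in_Hset {d k : ℕ} (M : AlmostMooreDigraph d k) (α : ℕ)
    {u v : M.V} (hu : u ∈ Hset M α) (hv : v ∈ Hset M α) :
    {w | w ∈ Hset M α ∧ M.Adj u w}.ncard = {w | w ∈ Hset M α ∧ M.Adj w v}.ncard := by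
  obtain ⟨v', rfl⟩ := M.rep_bijective.2 v
  have h := ncard_out_eq_ncard_in (fun x y => x ∈ Hset M α ∧ y ∈ Hset M α ∧ M.Adj x y)
    (Hset M α) k M.rep M.rep_bijective.1 (fun _ _ h => ⟨h.1, h.2.1⟩)
    (fun x y => by rw [rep_mem_Hset_iff, rep_mem_Hset_iff, ← M.rep_adj])
    (fun x hx y hy => by rw [sum_card_walkFinset_Hset M α hx hy]; congr)
    hu ((rep_mem_Hset_iff M α v').1 hv) hv
  simpa only [hu, hv, true_and] using h

/-- The subdigraph `H_α` is diregular: there is a `d'` such that every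
vertex of `H_α` has out-degree `d'` and in-degree `d'` within `H_α`. -/
theorem stmt4 {d k : ℕ} (M : AlmostMooreDigraph d k) (α : ℕ) (hα : 1 < α) :
    ∃ d' : ℕ, ∀ v ∈ Hset M α,
      {w | w ∈ Hset M α ∧ M.Adj v w}.ncard = d' ∧
      {w | w ∈ Hset M α ∧ M.Adj w v}.ncard = d' := by
  rcases (Hset M α).eq_empty_or_nonempty with hH | ⟨v₀, hv₀⟩
  · exact ⟨0, fun v hv => by simp [hH] at hv⟩
  · refine ⟨{w | w ∈ Hset M α ∧ M.Adj v₀ w}.ncard, fun v hv => ⟨?_, ?_⟩⟩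
    · rw [ncard_out_Hset_eq_ncard_in_Hset M α hv hv, ncard_out_Hset_eq_ncard_in_Hset M α hv₀ hv]
    · exact (ncard_out_Hset_eq_ncard_in_Hset M α hv₀ hv).symm
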